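/- Let $q>2$, $\rho\in(0,1)$, and define $\overline{\mathcal{J}}$, $\mathcal{J}$, $\mathcal{I}_\mathcal{J}$ as in the bivariate Gaussian-power example: $\overline{\mathcal{J}}(z_1,z_2)=\frac{z_1^{2/q}+z_2^{2/q}-2\rho z_1^{1/q}z_2^{1/q}}{2(1-\rho^2)}$, $\mathcal{J}(\bt)=\inf_{\bs\ge\bt}\overline{\mathcal{J}}(\bs)$, $\mathcal{I}_\mathcal{J}(\bt)=\min\{\mathcal{J}(\bu)+\mathcal{J}(\bv):\bu+\bv=\bt,\ \bu,\bv\ge0\}$. Then $\mathcal{I}_\mathcal{J}$ is neither convex nor concave on $\mathbb{R}_+^2$. -/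

import Mathlib

open Filter Real Set

/-- The bivariate Gaussian-power rate `J̄(z₁,z₂)`. -/
noncomputable def gaussJbar (q ρ : ℝ) (z : ℝ × ℝ) : ℝ :=
  (z.1 ^ (2 / q) + z.2 ^ (2 / q) - 2 * ρ * z.1 ^ (1 / q) * z.2 ^ (1 / q))
    / (2 * (1 - ρ ^ 2))

/-- The monotone envelope `J(t) = inf_{s ≥ t} J̄(s)`. -/
noncomputable def gaussJ (q ρ : ℝ) (t : ℝ × ℝ) : ℝ :=
  sInf {v : ℝ | ∃ s : ℝ × ℝ, t.1 ≤ s.1 ∧ t.2 ≤ s.2 ∧ v = gaussJbar q ρ s}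

/-- The two-summand rate function `I_J(t) = min{J(u)+J(v) : u+v = t, u,v ≥ 0}`. -/
noncomputable def gaussI (q ρ : ℝ) (t : ℝ × ℝ) : ℝ :=
  sInf {w : ℝ | ∃ u v : ℝ × ℝ, 0 ≤ u.1 ∧ 0 ≤ u.2 ∧ 0 ≤ v.1 ∧ 0 ≤ v.2 ∧
    u + v = t ∧ w = gaussJ q ρ u + gaussJ q ρ v}

theorem rpow_two_div_eq_sq {x q : ℝ} (hx : 0 ≤ x) : x ^ (2 / q) = (x ^ (1 / q)) ^ 2 := by
  rw [← Real.rpow_natCast, ← Real.rpow_mul hx]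
  congr 1
  push_cast
  ring

theorem le_gaussJbar {q ρ : ℝ} (hρ : ρ ∈ Set.Ioo (0 : ℝ) 1) {s : ℝ × ℝ}
    (h₁ : 0 ≤ s.1) (h₂ : 0 ≤ s.2) :
    s.1 ^ (2 / q) / 2 ≤ gaussJbar q ρ s ∧ s.2 ^ (2 / q) / 2 ≤ gaussJbar q ρ s := by
  have hd : 0 < 2 * (1 - ρ ^ 2) := by nlinarith [hρ.1, hρ.2]
  unfold gaussJbar
  rw [rpow_two_div_eq_sq h₁, rpow_two_div_eq_sq h₂, le_div_iff₀ hd, le_div_iff₀ hd]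
  constructor
  · nlinarith [sq_nonneg (s.2 ^ (1 / q) - ρ * s.1 ^ (1 / q))]
  · nlinarith [sq_nonneg (s.1 ^ (1 / q) - ρ * s.2 ^ (1 / q))]

theorem le_gaussJ {q ρ : ℝ} (hq : 2 < q) (hρ : ρ ∈ Set.Ioo (0 : ℝ) 1) {t : ℝ × ℝ}
    (h₁ : 0 ≤ t.1) (h₂ : 0 ≤ t.2) :
    t.1 ^ (2 / q) / 2 ≤ gaussJ q ρ t ∧ t.2 ^ (2 / q) / 2 ≤ gaussJ q ρ t := by
  have hp : 0 ≤ 2 / q := by positivity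
  constructor <;> refine le_csInf ⟨_, t, le_rfl, le_rfl, rfl⟩ ?_ <;> rintro _ ⟨s, hs₁, hs₂, rfl⟩
  · have := Real.rpow_le_rpow h₁ hs₁ hp
    linarith [(le_gaussJbar (q := q) hρ (h₁.trans hs₁) (h₂.trans hs₂)).1]
  · have := Real.rpow_le_rpow h₂ hs₂ hp
    linarith [(le_gaussJbar (q := q) hρ (h₁.trans hs₁) (h₂.trans hs₂)).2]

theorem gaussJ_nonneg {q ρ : ℝ} (hq : 2 < q) (hρ : ρ ∈ Set.Ioo (0 : ℝ) 1) {t : ℝ × ℝ}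
    (h₁ : 0 ≤ t.1) (h₂ : 0 ≤ t.2) : 0 ≤ gaussJ q ρ t :=
  le_trans (by positivity) (le_gaussJ hq hρ h₁ h₂).1

theorem gaussJ_le {q ρ : ℝ} (hq : 2 < q) (hρ : ρ ∈ Set.Ioo (0 : ℝ) 1) {t : ℝ × ℝ}
    (h₁ : 0 ≤ t.1) (h₂ : 0 ≤ t.2) (h : t.2 ≤ ρ ^ q * t.1) :
    gaussJ q ρ t ≤ t.1 ^ (2 / q) / 2 := by
  refine csInf_le ⟨0, ?_⟩ ⟨(t.1, ρ ^ q * t.1), le_rfl, h, ?_⟩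
  · rintro _ ⟨s, hs₁, hs₂, rfl⟩
    have hs₁' := h₁.trans hs₁
    exact le_trans (by positivity) (le_gaussJbar hρ hs₁' (h₂.trans hs₂)).1
  · have hρ₀ := hρ.1.le
    have hd : 1 - ρ ^ 2 ≠ 0 := by nlinarith [hρ.1, hρ.2]
    have hpow : (ρ ^ q * t.1) ^ (1 / q) = ρ * t.1 ^ (1 / q) := by
      rw [Real.mul_rpow (by positivity) h₁, ← Real.rpow_mul hρ₀,
        mul_one_div_cancel (by linarith), Real.rpow_one]
    simp only [gaussJbar]
    rw [rpow_two_div_eq_sq h₁, rpow_two_div_eq_sq (h₂.trans h), hpow]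
    field_simp
    ring

theorem le_gaussI {q ρ : ℝ} (hq : 2 < q) (hρ : ρ ∈ Set.Ioo (0 : ℝ) 1) {t : ℝ × ℝ}
    (h₁ : 0 ≤ t.1) (h₂ : 0 ≤ t.2) :
    t.1 ^ (2 / q) / 2 ≤ gaussI q ρ t ∧ t.2 ^ (2 / q) / 2 ≤ gaussI q ρ t := by
  have hp : 0 ≤ 2 / q := by positivity
  have hp' : 2 / q ≤ 1 := by rw [div_le_one (by linarith)]; exact hq.le
  constructor <;>
    refine le_csInf ⟨_, t, 0, h₁, h₂, le_rfl, le_rfl, add_zero t, rfl⟩ ?_ <;>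
    rintro _ ⟨u, v, hu₁, hu₂, hv₁, hv₂, rfl, rfl⟩
  · have := Real.rpow_add_le_add_rpow hu₁ hv₁ hp hp'
    rw [Prod.fst_add]
    linarith [(le_gaussJ hq hρ hu₁ hu₂).1, (le_gaussJ hq hρ hv₁ hv₂).1]
  · have := Real.rpow_add_le_add_rpow hu₂ hv₂ hp hp'
    rw [Prod.snd_add]
    linarith [(le_gaussJ hq hρ hu₁ hu₂).2, (le_gaussJ hq hρ hv₁ hv₂).2]

theorem gaussI_le {q ρ : ℝ} (hq : 2 < q) (hρ : ρ ∈ Set.Ioo (0 : ℝ) 1) {t : ℝ × ℝ}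
    (h₁ : 0 ≤ t.1) (h₂ : 0 ≤ t.2) (h : t.2 ≤ ρ ^ q * t.1) :
    gaussI q ρ t ≤ t.1 ^ (2 / q) / 2 := by
  have hle : gaussI q ρ t ≤ gaussJ q ρ t + gaussJ q ρ 0 := by
    refine csInf_le ⟨0, ?_⟩ ⟨t, 0, h₁, h₂, le_rfl, le_rfl, add_zero t, rfl⟩
    rintro _ ⟨u, v, hu₁, hu₂, hv₁, hv₂, -, rfl⟩
    exact add_nonneg (gaussJ_nonneg hq hρ hu₁ hu₂) (gaussJ_nonneg hq hρ hv₁ hv₂)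
  have hzero : gaussJ q ρ 0 ≤ 0 := by
    have := gaussJ_le hq hρ (t := 0) le_rfl le_rfl (by simp)
    rwa [Prod.fst_zero, Real.zero_rpow (by positivity), zero_div] at this
  linarith [gaussJ_le hq hρ h₁ h₂ h]

/-- For `q > 2` and `ρ ∈ (0,1)`, the rate function `I_J` of the
bivariate Gaussian-power example is neither convex nor concave on `ℝ₊²`. -/
theorem gauss_power_rate_not_convex_nor_concave
    (q ρ : ℝ) (hq : 2 < q) (hρ : ρ ∈ Set.Ioo (0:ℝ) 1) :
    ¬ ConvexOn ℝ {p : ℝ × ℝ | 0 ≤ p.1 ∧ 0 ≤ p.2} (gaussI q ρ) ∧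
    ¬ ConcaveOn ℝ {p : ℝ × ℝ | 0 ≤ p.1 ∧ 0 ≤ p.2} (gaussI q ρ) := by
  have hp : 0 < 2 / q := by positivity
  have hp' : 2 / q < 1 := by rwa [div_lt_one (by linarith)]
  have hr : 0 < ρ ^ q := Real.rpow_pos_of_pos hρ.1 q
  constructor
  · intro hc
    have hmid := hc.2 (show ((1, 0) : ℝ × ℝ) ∈ _ by simp) (show ((0, 0) : ℝ × ℝ) ∈ _ by simp)
      (show (0 : ℝ) ≤ 1 / 2 by norm_num) (show (0 : ℝ) ≤ 1 / 2 by norm_num) (by norm_num)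
    have hone := gaussI_le hq hρ (t := (1, 0)) (by simp) le_rfl (by simpa using hr.le)
    have hzero := gaussI_le hq hρ (t := (0, 0)) le_rfl le_rfl (by simp)
    have hhalf := (le_gaussI hq hρ (t := (1 / 2, 0)) (by norm_num) le_rfl).1
    have hlt : (1 / 2 : ℝ) < (1 / 2) ^ (2 / q) :=
      Real.self_lt_rpow_of_lt_one (by norm_num) (by norm_num) hp'
    have hpt : (1 / 2 : ℝ) • ((1, 0) : ℝ × ℝ) + (1 / 2 : ℝ) • (0, 0) = (1 / 2, 0) := by
      ext <;> simp
    rw [hpt, smul_eq_mul, smul_eq_mul] at hmid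
    simp only [Real.one_rpow, Real.zero_rpow hp.ne'] at hone hzero hhalf
    linarith
  · intro hc
    set a : ℝ := 1 / (1 + ρ ^ q) with ha
    have ha₀ : 0 < a := by positivity
    have ha₁ : a < 1 := by rw [ha, div_lt_one (by positivity)]; linarith
    have hab : 1 - a = ρ ^ q * a := by rw [ha]; field_simp; ring
    have hcomb := hc.2 (show ((1, 0) : ℝ × ℝ) ∈ _ by simp) (show ((0, 1) : ℝ × ℝ) ∈ _ by simp)
      ha₀.le (sub_nonneg.2 ha₁.le) (by ring)
    have hfst := (le_gaussI hq hρ (t := (1, 0)) (by simp) le_rfl).1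
    have hsnd := (le_gaussI hq hρ (t := (0, 1)) le_rfl (by simp)).2
    have hle := gaussI_le hq hρ (t := (a, 1 - a)) ha₀.le (sub_nonneg.2 ha₁.le) hab.le
    have hlt : a ^ (2 / q) < 1 := Real.rpow_lt_one ha₀.le ha₁ hp
    have hpt : a • ((1, 0) : ℝ × ℝ) + (1 - a) • (0, 1) = (a, 1 - a) := by
      ext <;> simp
    rw [hpt, smul_eq_mul, smul_eq_mul] at hcomb
    simp only [Real.one_rpow] at hfst hsnd hle
    nlinarith
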